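/- Let Σ ⊆ ℂⁿ be a closed complex analytic subvariety and K ⊆ Σ compact with K non-algebraic. Then for every point a ∈ ℂⁿ \ Σ and every M ≥ 1, the extremal function λ_d(a) = sup{|P(a)| : deg P ≤ d, sup_K|P| ≤ 1} satisfies λ_d(a) > M^d for all sufficiently large d. Consequently the projective hull of K (in ℂⁿ) is contained in Σ. -/

import Mathlib

open MvPolynomial

/-- The projective hull of a compact set K ⊆ ℂⁿ. -/
def projHull (n : ℕ) (K : Set (Fin n → ℂ)) : Set (Fin n → ℂ) :=
  {z | ∃ C : ℝ, 1 ≤ C ∧ ∀ d : ℕ, 1 ≤ d → ∀ P : MvPolynomial (Fin n) ℂ,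
    P.totalDegree ≤ d → (∀ w ∈ K, ‖eval w P‖ ≤ 1) → ‖eval z P‖ ≤ C ^ d}

section

open MeasureTheory Metric Set Filter Topology

/-- The closed annulus centred at the origin with the given radii. -/
def closedAnnulus (r r' : ℝ) : Set ℂ := {ζ | r ≤ ‖ζ‖ ∧ ‖ζ‖ ≤ r'}

lemma isCompact_closedAnnulus (r r' : ℝ) : IsCompact (closedAnnulus r r') := by
  refine (isCompact_closedBall (0 : ℂ) r').of_isClosed_subset ?_ fun ζ hζ => by simpa using hζ.2
  exact (isClosed_le continuous_const continuous_norm).inter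
    (isClosed_le continuous_norm continuous_const)

lemma setIntegral_closedAnnulus {r r' : ℝ} (hr : 0 < r) {f : ℂ → ℂ}
    (hf : ContinuousOn f (closedAnnulus r r')) :
    ∫ ζ in closedAnnulus r r', f ζ =
      ∫ s in Icc r r', ∫ θ in Ioo (-Real.pi) Real.pi, s • f (circleMap 0 s θ) := by
  have hmeas : MeasurableSet (closedAnnulus r r') := (isCompact_closedAnnulus r r').measurableSet
  have hsymm : ∀ p : ℝ × ℝ, Complex.polarCoord.symm p = circleMap 0 p.1 p.2 := fun p => by
    simp [circleMap, Complex.exp_mul_I]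
  rw [← integral_indicator hmeas, ← Complex.integral_comp_polarCoord_symm]
  have hset : ∀ p ∈ polarCoord.target,
      p.1 • (closedAnnulus r r').indicator f (Complex.polarCoord.symm p) =
        (Icc r r' ×ˢ Ioo (-Real.pi) Real.pi).indicator
          (fun q : ℝ × ℝ => q.1 • f (circleMap 0 q.1 q.2)) p := by
    intro p hp
    rw [polarCoord_target] at hp
    have h1 : (0 : ℝ) < p.1 := hp.1
    by_cases h : p.1 ∈ Icc r r'
    · rw [indicator_of_mem (show p ∈ Icc r r' ×ˢ Ioo (-Real.pi) Real.pi from ⟨h, hp.2⟩),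
        indicator_of_mem, hsymm]
      rw [hsymm]
      simpa [closedAnnulus, abs_of_pos h1] using h
    · rw [indicator_of_notMem (s := Icc r r' ×ˢ Ioo (-Real.pi) Real.pi) (fun h' => h h'.1),
        indicator_of_notMem, smul_zero]
      rw [hsymm]
      simpa [closedAnnulus, abs_of_pos h1] using h
  have hsub : Icc r r' ×ˢ Ioo (-Real.pi) Real.pi ⊆ polarCoord.target := by
    rw [polarCoord_target]
    exact prod_mono (fun s hs => hr.trans_le hs.1) subset_rfl
  rw [setIntegral_congr_fun polarCoord.open_target.measurableSet hset,
    setIntegral_indicator (measurableSet_Icc.prod measurableSet_Ioo),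
    inter_eq_self_of_subset_right hsub, Measure.volume_eq_prod]
  apply setIntegral_prod
  have hcont : ContinuousOn (fun q : ℝ × ℝ => q.1 • f (circleMap 0 q.1 q.2))
      (Icc r r' ×ˢ Icc (-Real.pi) Real.pi) := by
    refine continuousOn_fst.smul (hf.comp ?_ ?_)
    · unfold circleMap; fun_prop
    · intro p hp
      simpa [closedAnnulus, abs_of_pos (hr.trans_le hp.1.1)] using hp.1
  exact (hcont.integrableOn_compact (isCompact_Icc.prod isCompact_Icc)).mono_set
    (prod_mono subset_rfl Ioo_subset_Icc_self)

lemma integral_circleMap_symm (s : ℝ) (f : ℂ → ℂ) :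
    ∫ θ in Ioo (-Real.pi) Real.pi, f (circleMap 0 s θ) =
      (2 * Real.pi) • Real.circleAverage f 0 s := by
  rw [Real.circleAverage_def, smul_smul, mul_inv_cancel₀ (by positivity), one_smul,
    ← integral_Ioc_eq_integral_Ioo, ← intervalIntegral.integral_of_le (by linarith [Real.pi_pos])]
  have h : Function.Periodic (fun θ => f (circleMap 0 s θ)) (2 * Real.pi) := fun θ => by
    simp [periodic_circleMap 0 s θ]
  have := h.intervalIntegral_add_eq (-Real.pi) 0
  rw [zero_add] at this
  rw [← this]
  congr 1; ring

lemma circleAverage_div_sub_of_lt {s : ℝ} {ξ : ℂ} (h : ‖ξ‖ < s) :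
    Real.circleAverage (fun ζ => ζ * (ζ - ξ)⁻¹) 0 s = 1 := by
  have hs : 0 < s := (norm_nonneg _).trans_lt h
  rw [Real.circleAverage_eq_circleIntegral hs.ne']
  have : ∮ z in C(0, s), (z - 0)⁻¹ • (z * (z - ξ)⁻¹) = ∮ z in C(0, s), (z - ξ)⁻¹ := by
    refine circleIntegral.integral_congr hs.le fun z hz => ?_
    have hz0 : z ≠ 0 := by
      rintro rfl
      simp at hz; exact hs.ne hz
    simp only [sub_zero, smul_eq_mul]
    rw [inv_mul_cancel_left₀ hz0]
  rw [this, circleIntegral.integral_sub_inv_of_mem_ball (by simpa using h), smul_eq_mul,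
    inv_mul_cancel₀]
  simp [Real.pi_ne_zero]

lemma circleAverage_div_sub_of_gt {s : ℝ} (hs : 0 < s) {ξ : ℂ} (h : s < ‖ξ‖) :
    Real.circleAverage (fun ζ => ζ * (ζ - ξ)⁻¹) 0 s = 0 := by
  have hne : ∀ z ∈ closedBall (0 : ℂ) s, z - ξ ≠ 0 := fun z hz hz' => by
    rw [sub_eq_zero.mp hz'] at hz
    simp at hz; linarith
  rw [Real.circleAverage_eq_circleIntegral hs.ne']
  have : ∮ z in C(0, s), (z - 0)⁻¹ • (z * (z - ξ)⁻¹) = ∮ z in C(0, s), (z - ξ)⁻¹ := by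
    refine circleIntegral.integral_congr hs.le fun z hz => ?_
    have hz0 : z ≠ 0 := by
      rintro rfl
      simp at hz; exact hs.ne hz
    simp only [sub_zero, smul_eq_mul]
    rw [inv_mul_cancel_left₀ hz0]
  rw [this, Complex.circleIntegral_eq_zero_of_differentiable_on_off_countable hs.le
    countable_empty, smul_zero]
  · exact ContinuousOn.inv₀ (by fun_prop) hne
  · intro z hz
    exact DifferentiableAt.inv (by fun_prop) (hne z (ball_subset_closedBall hz.1))

/-- The radial average of the Cauchy kernels of the circles in an annulus. -/
noncomputable def annulusKernel (r r' : ℝ) (ζ : ℂ) : ℂ :=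
  ((2 * Real.pi * (r' - r) : ℝ) : ℂ)⁻¹ * (ζ / (‖ζ‖ : ℂ))

lemma continuousOn_annulusKernel {r r' : ℝ} (hr : 0 < r) :
    ContinuousOn (annulusKernel r r') (closedAnnulus r r') := by
  unfold annulusKernel
  refine continuousOn_const.mul (continuousOn_id.div (by fun_prop) fun ζ hζ => ?_)
  exact_mod_cast (hr.trans_le hζ.1).ne'

lemma setIntegral_annulusKernel_aux {r r' : ℝ} (hr : 0 < r) (hr' : r < r') {ξ c : ℂ}
    (hξ : ∀ ζ ∈ closedAnnulus r r', ζ - ξ ≠ 0)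
    (h : ∀ s ∈ Icc r r', Real.circleAverage (fun ζ => ζ * (ζ - ξ)⁻¹) 0 s = c) :
    ∫ ζ in closedAnnulus r r', annulusKernel r r' ζ * (ζ - ξ)⁻¹ = c := by
  rw [setIntegral_closedAnnulus (f := fun ζ => annulusKernel r r' ζ * (ζ - ξ)⁻¹) hr
    ((continuousOn_annulusKernel hr).mul (ContinuousOn.inv₀ (by fun_prop) hξ))]
  have : ∀ s ∈ Icc r r', ∫ θ in Ioo (-Real.pi) Real.pi,
      s • (annulusKernel r r' (circleMap 0 s θ) * (circleMap 0 s θ - ξ)⁻¹) =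
        ((r' - r : ℝ) : ℂ)⁻¹ * c := by
    intro s hs
    have hs0 : 0 < s := hr.trans_le hs.1
    have h1 : ∀ θ : ℝ, s • (annulusKernel r r' (circleMap 0 s θ) * (circleMap 0 s θ - ξ)⁻¹) =
        ((2 * Real.pi * (r' - r) : ℝ) : ℂ)⁻¹ * (circleMap 0 s θ * (circleMap 0 s θ - ξ)⁻¹) := by
      intro θ
      have hs' : (s : ℂ) ≠ 0 := by exact_mod_cast hs0.ne'
      simp only [annulusKernel, norm_circleMap_zero, abs_of_pos hs0, Complex.real_smul]
      field_simp
    simp_rw [h1]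
    rw [integral_const_mul, integral_circleMap_symm s (fun ζ => ζ * (ζ - ξ)⁻¹), h s hs,
      Complex.real_smul]
    have hpi : (Real.pi : ℂ) ≠ 0 := by exact_mod_cast Real.pi_ne_zero
    have : ((r' : ℂ) - r) ≠ 0 := by exact_mod_cast (sub_pos.mpr hr').ne'
    push_cast
    field_simp
  rw [setIntegral_congr_fun measurableSet_Icc this, setIntegral_const]
  have h2 : ((r' : ℂ) - r) ≠ 0 := by exact_mod_cast (sub_pos.mpr hr').ne'
  simp only [Real.volume_real_Icc_of_le hr'.le, Complex.real_smul]
  push_cast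
  field_simp

lemma setIntegral_annulusKernel_of_lt {r r' : ℝ} (hr : 0 < r) (hr' : r < r') {ξ : ℂ}
    (hξ : ‖ξ‖ < r) :
    ∫ ζ in closedAnnulus r r', annulusKernel r r' ζ * (ζ - ξ)⁻¹ = 1 :=
  setIntegral_annulusKernel_aux hr hr'
    (fun ζ hζ h => by
      rw [sub_eq_zero.mp h] at hζ
      exact hξ.not_ge hζ.1)
    fun _ hs => circleAverage_div_sub_of_lt (hξ.trans_le hs.1)

lemma setIntegral_annulusKernel_of_gt {r r' : ℝ} (hr : 0 < r) (hr' : r < r') {ξ : ℂ}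
    (hξ : r' < ‖ξ‖) :
    ∫ ζ in closedAnnulus r r', annulusKernel r r' ζ * (ζ - ξ)⁻¹ = 0 :=
  setIntegral_annulusKernel_aux hr hr'
    (fun ζ hζ h => by
      rw [sub_eq_zero.mp h] at hζ
      exact hξ.not_ge hζ.2)
    fun _ hs => circleAverage_div_sub_of_gt (hr.trans_le hs.1) (hs.2.trans_lt hξ)

lemma norm_annulusKernel_le {r r' : ℝ} (hr' : r < r') (ζ : ℂ) :
    ‖annulusKernel r r' ζ‖ ≤ (2 * Real.pi * (r' - r))⁻¹ := by
  have h : 0 < 2 * Real.pi * (r' - r) := mul_pos (by positivity) (sub_pos.mpr hr')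
  have h1 : ‖ζ / (‖ζ‖ : ℂ)‖ ≤ 1 := by
    simpa using div_self_le_one ‖ζ‖
  rw [annulusKernel, norm_mul, norm_inv, Complex.norm_real, Real.norm_of_nonneg h.le]
  exact mul_le_of_le_one_right (by positivity) h1

lemma locallyIntegrable_norm_sub_inv (ξ : ℂ) :
    LocallyIntegrable (fun ζ : ℂ => ‖ζ - ξ‖⁻¹) := by
  have h0 : LocallyIntegrable (fun ζ : ℂ => ‖ζ‖⁻¹) := by
    refine locallyIntegrable_of_norm_le_rpow (C := 1) (α := 1) (by simp) (by simp) ?_ ?_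
    · filter_upwards with ζ
      simp [Real.rpow_neg_one]
    · exact (measurable_norm.inv).aestronglyMeasurable
  rw [locallyIntegrable_iff] at h0 ⊢
  intro k hk
  have h1 := h0 (k := (fun ζ => ζ - ξ) '' k) (hk.image (by fun_prop))
  have := (measurePreserving_sub_right (volume : Measure ℂ) ξ).integrableOn_image
    (MeasurableEquiv.subRight ξ).measurableEmbedding (f := fun ζ : ℂ => ‖ζ‖⁻¹) (s := k)
  exact this.mp h1

lemma exists_setIntegral_norm_sub_inv_le {A : Set ℂ} (hA : IsCompact A) :
    ∃ C : ℝ, ∀ ξ : ℂ, ∫ ζ in A, ‖ζ - ξ‖⁻¹ ≤ C := by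
  refine ⟨(∫ ζ in closedBall (0 : ℂ) 1, ‖ζ‖⁻¹) + volume.real A, fun ξ => ?_⟩
  have hint := (locallyIntegrable_norm_sub_inv ξ).integrableOn_isCompact (isCompact_closedBall ξ 1)
  have h1 : ∫ ζ in closedBall (0 : ℂ) 1, ‖ζ‖⁻¹ = ∫ ζ in closedBall ξ 1, ‖ζ - ξ‖⁻¹ := by
    have := (measurePreserving_sub_right (volume : Measure ℂ) ξ).setIntegral_preimage_emb
      (MeasurableEquiv.subRight ξ).measurableEmbedding (fun ζ : ℂ => ‖ζ‖⁻¹) (closedBall 0 1)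
    rw [← this]
    congr 2
    ext ζ
    simp [dist_eq_norm]
  rw [h1, ← integral_indicator isClosed_closedBall.measurableSet]
  have hAfin : volume A ≠ ⊤ := hA.measure_lt_top.ne
  have hc : volume.real A = ∫ ζ in A, (1 : ℝ) := by simp
  have hind : Integrable ((closedBall ξ 1).indicator fun ζ => ‖ζ - ξ‖⁻¹) :=
    (integrable_indicator_iff isClosed_closedBall.measurableSet).mpr hint
  have hle : ∫ ζ in A, (closedBall ξ 1).indicator (fun ζ => ‖ζ - ξ‖⁻¹) ζ ≤
      ∫ ζ, (closedBall ξ 1).indicator (fun ζ => ‖ζ - ξ‖⁻¹) ζ :=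
    setIntegral_le_integral hind (ae_of_all _ fun ζ =>
      indicator_nonneg (fun _ _ => by positivity) ζ)
  have hone : IntegrableOn (fun _ : ℂ => (1 : ℝ)) A := integrableOn_const hAfin
  rw [hc]
  refine le_trans ?_ (add_le_add_left hle _)
  rw [← integral_add hind.integrableOn hone]
  refine integral_mono ((locallyIntegrable_norm_sub_inv ξ).integrableOn_isCompact hA)
    (hind.integrableOn.add hone) fun ζ => ?_
  by_cases h : ζ ∈ closedBall ξ 1
  · simp [indicator_of_mem h]
  · simp only [indicator_of_notMem h, zero_add]
    rw [mem_closedBall, not_le, dist_eq_norm] at h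
    exact inv_le_one_of_one_le₀ h.le

/-- The polynomially convex hull of a set `B ⊆ ℂ^σ`. -/
def polyHull {σ : Type*} (B : Set (σ → ℂ)) : Set (σ → ℂ) :=
  {x | ∀ (P : MvPolynomial σ ℂ) (c : ℝ), 0 ≤ c → (∀ b ∈ B, ‖eval b P‖ ≤ c) → ‖eval x P‖ ≤ c}

section BanachAlgebra

variable {A : Type*} [NormedCommRing A] [NormedAlgebra ℂ A] [CompleteSpace A]

lemma exists_norm_pow_lt_of_forall_character {a : A}
    (h : ∀ χ : WeakDual.characterSpace ℂ A, ‖χ a‖ < 1) {τ : ℝ} (hτ : 0 < τ) :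
    ∃ N : ℕ, 0 < N ∧ ‖a ^ N‖ < τ := by
  rcases subsingleton_or_nontrivial A with hA | hA
  · exact ⟨1, one_pos, by simpa [Subsingleton.elim a 0] using hτ⟩
  have h1 : spectralRadius ℂ a < (1 : NNReal) := by
    refine spectrum.spectralRadius_lt_of_forall_lt a fun z hz => ?_
    obtain ⟨χ, rfl⟩ := WeakDual.CharacterSpace.mem_spectrum_iff_exists.mp hz
    exact h χ
  obtain ⟨c, hc, hc1⟩ := ENNReal.lt_iff_exists_nnreal_btwn.mp h1
  have hc1' : (c : ℝ) < 1 := by exact_mod_cast hc1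
  have h2 := (spectrum.gelfand_formula a).eventually_lt_const hc
  have h3 := (tendsto_pow_atTop_nhds_zero_of_lt_one c.2 hc1').eventually_lt_const hτ
  obtain ⟨N, hN, hNτ, hN0⟩ := (h2.and (h3.and (eventually_gt_atTop 0))).exists
  refine ⟨N, hN0, lt_of_le_of_lt ?_ hNτ⟩
  have hN' : ((N : ℝ)) ≠ 0 := by exact_mod_cast hN0.ne'
  have h4 := ENNReal.rpow_le_rpow hN.le (z := (N : ℝ)) (by positivity)
  rw [← ENNReal.rpow_mul, one_div, inv_mul_cancel₀ hN', ENNReal.rpow_one,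
    ENNReal.rpow_natCast] at h4
  exact_mod_cast h4

lemma exists_norm_pow_sub_mul_lt_of_forall_character {φ g : A}
    (h : ∀ χ : WeakDual.characterSpace ℂ A, χ φ = 0 → ‖χ g‖ < 1) {τ : ℝ} (hτ : 0 < τ) :
    ∃ N : ℕ, 0 < N ∧ ∃ u : A, ‖g ^ N - φ * u‖ < τ := by
  set I : Ideal A := (Ideal.span {φ}).closure with hI
  have hIc : IsClosed (I : Set A) := isClosed_closure
  have hφ : φ ∈ I := subset_closure (Ideal.mem_span_singleton_self φ)
  obtain ⟨N, hN, hlt⟩ := exists_norm_pow_lt_of_forall_character (A := A ⧸ I)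
    (a := Ideal.Quotient.mk I g) (fun χ => by
      let ψ : A →ₐ[ℂ] ℂ :=
        (WeakDual.CharacterSpace.toAlgHom χ).comp (Ideal.Quotient.mkₐ ℂ I)
      have := h (WeakDual.CharacterSpace.equivAlgHom.symm ψ) (by
        change χ (Ideal.Quotient.mk I φ) = 0
        rw [Ideal.Quotient.eq_zero_iff_mem.mpr hφ, map_zero])
      exact this) hτ
  refine ⟨N, hN, ?_⟩
  rw [← map_pow] at hlt
  obtain ⟨r, hr, hrlt⟩ := Ideal.Quotient.norm_mk_lt (Ideal.Quotient.mk I (g ^ N))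
    (sub_pos.mpr hlt)
  rw [add_sub_cancel] at hrlt
  have hmem : g ^ N - r ∈ closure ((Ideal.span {φ} : Ideal A) : Set A) := by
    rw [← Ideal.coe_closure, SetLike.mem_coe, ← hI]
    exact Ideal.Quotient.eq.mp hr.symm
  obtain ⟨v, hv, hvd⟩ := Metric.mem_closure_iff.mp hmem (τ - ‖r‖) (sub_pos.mpr hrlt)
  obtain ⟨u, rfl⟩ := Ideal.mem_span_singleton'.mp hv
  refine ⟨u, ?_⟩
  rw [dist_eq_norm] at hvd
  calc ‖g ^ N - φ * u‖ = ‖(g ^ N - r - u * φ) + r‖ := by congr 1; ring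
    _ ≤ ‖g ^ N - r - u * φ‖ + ‖r‖ := norm_add_le _ _
    _ < τ := by linarith

end BanachAlgebra

/-- Evaluation of polynomials as continuous functions on a subset of `ℂ^σ`. -/
noncomputable def polyRestrict {σ : Type*} (B : Set (σ → ℂ)) :
    MvPolynomial σ ℂ →ₐ[ℂ] C(B, ℂ) :=
  aeval fun i => ⟨fun b => b.1 i, (continuous_apply i).comp continuous_subtype_val⟩

lemma polyRestrict_apply {σ : Type*} (B : Set (σ → ℂ)) (P : MvPolynomial σ ℂ) (b : B) :
    polyRestrict B P b = eval b.1 P := by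
  induction P using MvPolynomial.induction_on with
  | C a => simp [polyRestrict]
  | add p q hp hq => simp [hp, hq]
  | mul_X p i hp => simp only [map_mul, ContinuousMap.mul_apply, hp]; simp [polyRestrict]

lemma exists_pow_sub_mul_lt {σ : Type*} {B : Set (σ → ℂ)} (hB : IsCompact B)
    {φ g : MvPolynomial σ ℂ} (h : ∀ y ∈ polyHull B, eval y φ = 0 → ‖eval y g‖ < 1)
    {τ : ℝ} (hτ : 0 < τ) :
    ∃ N : ℕ, 0 < N ∧ ∃ u : MvPolynomial σ ℂ, ∀ b ∈ B, ‖eval b (g ^ N - φ * u)‖ < τ := by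
  have : CompactSpace B := isCompact_iff_compactSpace.mp hB
  let S : Subalgebra ℂ C(B, ℂ) := (polyRestrict B).range
  let A := S.topologicalClosure
  have : CompleteSpace A := S.isClosed_topologicalClosure.completeSpace_coe
  let ι : MvPolynomial σ ℂ →ₐ[ℂ] A :=
    (Subalgebra.inclusion S.le_topologicalClosure).comp (polyRestrict B).rangeRestrict
  have hι : ∀ P, ((ι P : A) : C(B, ℂ)) = polyRestrict B P := fun P => rfl
  have hnorm : ∀ P (c : ℝ), 0 ≤ c → (∀ b ∈ B, ‖eval b P‖ ≤ c) → ‖ι P‖ ≤ c := by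
    intro P c hc hP
    change ‖(ι P : C(B, ℂ))‖ ≤ c
    rw [hι, ContinuousMap.norm_le _ hc]
    intro b
    rw [polyRestrict_apply]
    exact hP b b.2
  have hone : ‖(1 : A)‖ ≤ 1 := by
    rw [← map_one ι]
    exact hnorm 1 1 zero_le_one (by simp)
  obtain ⟨N, hN, u, hu⟩ := exists_norm_pow_sub_mul_lt_of_forall_character (A := A)
    (φ := ι φ) (g := ι g) (fun χ hχ => by
      let ψ : A →ₐ[ℂ] ℂ := WeakDual.CharacterSpace.toAlgHom χ
      have heval : ∀ P, eval (fun i => χ (ι (X i))) P = χ (ι P) := by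
        intro P
        have : (aeval fun i => χ (ι (X i))) = ψ.comp ι := by
          ext i; simp [ψ]
        have := DFunLike.congr_fun this P
        rwa [MvPolynomial.aeval_eq_eval] at this
      rw [← heval] at hχ ⊢
      refine h _ (fun P c hc hP => ?_) hχ
      rw [heval]
      refine (spectrum.norm_le_norm_mul_of_mem (AlgHom.apply_mem_spectrum ψ (ι P))).trans ?_
      exact (mul_le_mul (hnorm P c hc hP) hone (norm_nonneg _) hc).trans_eq (mul_one c)) hτ
  refine ⟨N, hN, ?_⟩
  have hlt : 0 < τ - ‖ι g ^ N - ι φ * u‖ := sub_pos.mpr hu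
  obtain ⟨v, ⟨_, ⟨P, rfl⟩, hvP⟩, hvu⟩ : ∃ v : A, (∃ w ∈ S, (v : C(B, ℂ)) = w) ∧
      ‖ι φ * (u - v)‖ < τ - ‖ι g ^ N - ι φ * u‖ := by
    have hc : (u : C(B, ℂ)) ∈ closure (S : Set C(B, ℂ)) := u.2
    obtain ⟨w, hw, hwd⟩ := Metric.mem_closure_iff.mp hc
      ((τ - ‖ι g ^ N - ι φ * u‖) / (‖ι φ‖ + 1)) (by positivity)
    refine ⟨⟨w, S.le_topologicalClosure hw⟩, ⟨w, hw, rfl⟩, ?_⟩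
    rw [dist_eq_norm] at hwd
    calc _ ≤ ‖ι φ‖ * ‖u - ⟨w, S.le_topologicalClosure hw⟩‖ := norm_mul_le _ _
      _ ≤ (‖ι φ‖ + 1) * ‖u - ⟨w, S.le_topologicalClosure hw⟩‖ := by gcongr; linarith
      _ < (‖ι φ‖ + 1) * ((τ - ‖ι g ^ N - ι φ * u‖) / (‖ι φ‖ + 1)) := by gcongr; exact hwd
      _ = _ := by field_simp
  have hvP' : v = ι P := Subtype.ext hvP
  refine ⟨P, fun b hb => ?_⟩
  have h1 : ‖ι (g ^ N - φ * P)‖ < τ := by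
    rw [map_sub, map_pow, map_mul, ← hvP']
    calc ‖ι g ^ N - ι φ * v‖ = ‖(ι g ^ N - ι φ * u) + ι φ * (u - v)‖ := by congr 1; ring
      _ ≤ _ := norm_add_le _ _
      _ < τ := by linarith
  have h2 := (ι (g ^ N - φ * P) : C(B, ℂ)).norm_coe_le_norm ⟨b, hb⟩
  rw [hι, polyRestrict_apply] at h2
  exact h2.trans_lt h1

lemma integrableOn_annulusKernel_mul {r r' : ℝ} (hr' : r < r') (ξ : ℂ) :
    IntegrableOn (fun ζ => annulusKernel r r' ζ * (ζ - ξ)⁻¹) (closedAnnulus r r') := by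
  refine Integrable.mono' (((locallyIntegrable_norm_sub_inv ξ).integrableOn_isCompact
    (isCompact_closedAnnulus r r')).const_mul ((2 * Real.pi * (r' - r))⁻¹)) ?_ ?_
  · refine Measurable.aestronglyMeasurable ?_
    unfold annulusKernel
    fun_prop
  · filter_upwards with ζ
    rw [norm_mul, norm_inv]
    gcongr
    exact norm_annulusKernel_le hr' ζ

lemma exists_setIntegral_annulusKernel_le {r r' : ℝ} (hr' : r < r') :
    ∃ M : ℝ, 0 < M ∧ ∀ ξ : ℂ,
      ∫ ζ in closedAnnulus r r', ‖annulusKernel r r' ζ * (ζ - ξ)⁻¹‖ ≤ M := by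
  obtain ⟨C, hC⟩ := exists_setIntegral_norm_sub_inv_le (isCompact_closedAnnulus r r')
  have h : 0 < 2 * Real.pi * (r' - r) := mul_pos (by positivity) (sub_pos.mpr hr')
  refine ⟨(2 * Real.pi * (r' - r))⁻¹ * |C| + 1, by positivity, fun ξ => ?_⟩
  calc ∫ ζ in closedAnnulus r r', ‖annulusKernel r r' ζ * (ζ - ξ)⁻¹‖
      ≤ ∫ ζ in closedAnnulus r r', (2 * Real.pi * (r' - r))⁻¹ * ‖ζ - ξ‖⁻¹ := by
        refine integral_mono (integrableOn_annulusKernel_mul hr' ξ).norm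
          (((locallyIntegrable_norm_sub_inv ξ).integrableOn_isCompact
            (isCompact_closedAnnulus r r')).const_mul _) fun ζ => ?_
        simp only [norm_mul, norm_inv]
        gcongr
        exact norm_annulusKernel_le hr' ζ
    _ = (2 * Real.pi * (r' - r))⁻¹ * ∫ ζ in closedAnnulus r r', ‖ζ - ξ‖⁻¹ := integral_const_mul _ _
    _ ≤ (2 * Real.pi * (r' - r))⁻¹ * |C| := by
        gcongr
        exact (hC ξ).trans (le_abs_self C)
    _ ≤ _ := by linarith

lemma continuous_eval_mvPolynomial {σ : Type*} (P : MvPolynomial σ ℂ) :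
    Continuous fun x : σ → ℂ => eval x P := P.continuous_eval

lemma isOpen_setOf_forall_norm_eval_lt {σ : Type*} {B : Set (σ → ℂ)} (hB : IsCompact B)
    (φ G u : MvPolynomial σ ℂ) (τ : ℝ) :
    IsOpen {ζ : ℂ | ∀ b ∈ B, ‖eval b (G - (φ - C ζ) * u)‖ < τ} := by
  rw [isOpen_iff_eventually]
  intro ζ hζ
  refine hB.eventually_forall_of_forall_eventually fun b hb => ?_
  have hcont : Continuous fun p : ℂ × (σ → ℂ) => ‖eval p.2 (G - (φ - C p.1) * u)‖ := by
    simp only [map_sub, map_mul, eval_C]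
    have h := fun P : MvPolynomial σ ℂ =>
      (continuous_eval_mvPolynomial P).comp (continuous_snd (X := ℂ))
    exact ((h G).sub (((h φ).sub continuous_fst).mul (h u))).norm
  exact hcont.continuousAt.eventually_lt_const (hζ b hb)

lemma exists_norm_eval_sub_mul_integral_le {σ : Type*} {B : Set (σ → ℂ)} (hB : IsCompact B)
    {φ G : MvPolynomial σ ℂ} {r r' τ M : ℝ} (hr : 0 < r) (hr' : r < r')
    (hτ : 0 < τ)
    (hM : ∀ ξ : ℂ, ∫ ζ in closedAnnulus r r', ‖annulusKernel r r' ζ * (ζ - ξ)⁻¹‖ ≤ M)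
    (h : ∀ ζ ∈ closedAnnulus r r', ∃ u : MvPolynomial σ ℂ,
      ∀ b ∈ B, ‖eval b (G - (φ - C ζ) * u)‖ < τ) :
    ∃ H : MvPolynomial σ ℂ, ∀ y ∈ polyHull B,
      ‖eval y H - eval y G *
        ∫ ζ in closedAnnulus r r', annulusKernel r r' ζ * (ζ - eval y φ)⁻¹‖ ≤ τ * M := by
  have hA := isCompact_closedAnnulus r r'
  choose! u hu using h
  let U : ℂ → Set ℂ := fun ζ => {ζ' | ∀ b ∈ B, ‖eval b (G - (φ - C ζ') * u ζ)‖ < τ}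
  obtain ⟨t, htA, ht⟩ := hA.elim_nhds_subcover U fun ζ hζ =>
    (isOpen_setOf_forall_norm_eval_lt hB φ G (u ζ) τ).mem_nhds (hu ζ hζ)
  let e : Fin t.card → ℂ := fun i => t.equivFin.symm i
  obtain ⟨ρ, hρU, hρ1, hρI, -⟩ := exists_continuous_sum_one_of_isOpen_isCompact
    (s := fun i => U (e i))
    (fun i => isOpen_setOf_forall_norm_eval_lt hB φ G (u (e i)) τ) hA (fun ζ hζ => by
      obtain ⟨z, hz, hzU⟩ := mem_iUnion₂.mp (ht hζ)
      exact mem_iUnion.mpr ⟨t.equivFin ⟨z, hz⟩, by simpa [e] using hzU⟩)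
  have hρint : ∀ i, IntegrableOn (fun ζ => annulusKernel r r' ζ * (ρ i ζ : ℂ))
      (closedAnnulus r r') := fun i =>
    ((continuousOn_annulusKernel hr).mul (by fun_prop)).integrableOn_compact hA
  refine ⟨-∑ i, C (∫ ζ in closedAnnulus r r', annulusKernel r r' ζ * (ρ i ζ : ℂ)) * u (e i),
    fun y hy => ?_⟩
  set ξ := eval y φ
  have hkint := integrableOn_annulusKernel_mul hr' ξ
  have hH : eval y (-∑ i, C (∫ ζ in closedAnnulus r r', annulusKernel r r' ζ * (ρ i ζ : ℂ)) *
      u (e i)) - eval y G * ∫ ζ in closedAnnulus r r', annulusKernel r r' ζ * (ζ - ξ)⁻¹ =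
      ∫ ζ in closedAnnulus r r', (-(∑ i, annulusKernel r r' ζ * (ρ i ζ : ℂ) * eval y (u (e i))) -
        eval y G * (annulusKernel r r' ζ * (ζ - ξ)⁻¹)) := by
    rw [integral_sub _ (hkint.const_mul _), integral_neg, integral_finsetSum, integral_const_mul]
    · simp only [map_neg, map_sum, map_mul, eval_C, integral_mul_const]
    · exact fun i _ => (hρint i).mul_const _
    · exact (integrable_finsetSum _ fun i _ => (hρint i).mul_const _).neg
  rw [hH]
  refine (norm_integral_le_of_norm_le (hkint.norm.const_mul τ) ?_).trans ?_
  · have hne : ∀ᵐ ζ ∂(volume.restrict (closedAnnulus r r')), ζ ≠ ξ := ae_restrict_of_ae (by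
      simp [ae_iff])
    filter_upwards [hne, ae_restrict_mem hA.measurableSet] with ζ hζ hζA
    have hζ' : ζ - ξ ≠ 0 := sub_ne_zero.mpr hζ
    have hsum : ∑ i, (ρ i ζ : ℂ) = 1 := by
      have := hρ1 hζA
      simp only [Finset.sum_apply, Pi.one_apply] at this
      exact_mod_cast this
    have hident : -(∑ i, annulusKernel r r' ζ * (ρ i ζ : ℂ) * eval y (u (e i))) -
        eval y G * (annulusKernel r r' ζ * (ζ - ξ)⁻¹) =
        -(annulusKernel r r' ζ * (ζ - ξ)⁻¹) *
          ∑ i, (ρ i ζ : ℂ) * eval y (G - (φ - C ζ) * u (e i)) := by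
      simp only [map_sub, map_mul, eval_C, mul_sub, Finset.sum_sub_distrib]
      rw [← Finset.sum_mul, hsum]
      have : ∀ i, annulusKernel r r' ζ * (ρ i ζ : ℂ) * eval y (u (e i)) =
          (annulusKernel r r' ζ * (ζ - ξ)⁻¹) *
            ((ρ i ζ : ℂ) * ((ζ - ξ) * eval y (u (e i)))) := by
        intro i; field_simp
      simp_rw [this]
      rw [← Finset.mul_sum]
      have h2 : ∀ i, (ρ i ζ : ℂ) * ((eval y φ - ζ) * eval y (u (e i))) =
          -((ρ i ζ : ℂ) * ((ζ - ξ) * eval y (u (e i)))) := by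
        intro i; simp only [ξ]; ring
      simp_rw [h2, Finset.sum_neg_distrib]
      ring
    rw [hident, norm_mul, norm_neg, mul_comm τ]
    gcongr
    refine (norm_sum_le _ _).trans ?_
    have hle : ∀ i ∈ Finset.univ, ‖(ρ i ζ : ℂ) * eval y (G - (φ - C ζ) * u (e i))‖ ≤
        ρ i ζ * τ := by
      intro i _
      rw [norm_mul, Complex.norm_real, Real.norm_of_nonneg (hρI i ζ).1]
      by_cases h0 : ρ i ζ = 0
      · simp [h0]
      · have hmem : ζ ∈ U (e i) := hρU i (subset_tsupport _ h0)
        exact mul_le_mul_of_nonneg_left (hy _ τ hτ.le fun b hb => (hmem b hb).le) (hρI i ζ).1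
    refine (Finset.sum_le_sum hle).trans ?_
    rw [← Finset.sum_mul]
    have : ∑ i, ρ i ζ = 1 := by exact_mod_cast hsum
    rw [this, one_mul]
  · rw [integral_const_mul]
    exact mul_le_mul_of_nonneg_left (hM ξ) hτ.le

lemma subset_polyHull {σ : Type*} (B : Set (σ → ℂ)) : B ⊆ polyHull B :=
  fun _ hb _ _ _ h => h _ hb

lemma polyHull_subset_of_subset_polyHull {σ : Type*} {B B' : Set (σ → ℂ)} (h : B' ⊆ polyHull B) :
    polyHull B' ⊆ polyHull B :=
  fun _ hx P c hc hB => hx P c hc fun _ hb => h hb P c hc hB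

lemma polyHull_mono {σ : Type*} {B B' : Set (σ → ℂ)} (h : B' ⊆ B) : polyHull B' ⊆ polyHull B :=
  polyHull_subset_of_subset_polyHull (h.trans (subset_polyHull B))

lemma isClosed_polyHull {σ : Type*} (B : Set (σ → ℂ)) : IsClosed (polyHull B) := by
  simp only [polyHull, ofPred_forall]
  exact isClosed_iInter fun P => isClosed_iInter fun c => isClosed_iInter fun _ =>
    isClosed_iInter fun _ => isClosed_le (continuous_eval_mvPolynomial P).norm continuous_const

lemma isCompact_polyHull {σ : Type*} [Fintype σ] {B : Set (σ → ℂ)} (hB : IsCompact B) :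
    IsCompact (polyHull B) := by
  obtain ⟨R, hR⟩ := hB.isBounded.exists_norm_le
  refine (isCompact_closedBall (0 : σ → ℂ) (max R 0)).of_isClosed_subset (isClosed_polyHull B)
    fun x hx => ?_
  rw [mem_closedBall_zero_iff, pi_norm_le_iff_of_nonneg (le_max_right _ _)]
  intro i
  rw [← eval_X (f := x) i]
  refine hx (X i) (max R 0) (le_max_right _ _) fun b hb => ?_
  rw [eval_X]
  exact (norm_le_pi_norm b i).trans ((hR b hb).trans (le_max_left _ _))

lemma IsCompact.exists_gt_forall_lt {α : Type*} [TopologicalSpace α] {Z : Set α} (hZ : IsCompact Z)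
    {f : α → ℝ} (hf : Continuous f) {r : ℝ} (h : ∀ z ∈ Z, r < f z) :
    ∃ r', r < r' ∧ ∀ z ∈ Z, r' < f z := by
  rcases Z.eq_empty_or_nonempty with rfl | hne
  · exact ⟨r + 1, by simp, by simp⟩
  · obtain ⟨z, hz, hmin⟩ := hZ.exists_isMinOn hne hf.continuousOn
    obtain ⟨r', h1, h2⟩ := exists_between (h z hz)
    exact ⟨r', h1, fun w hw => h2.trans_le (hmin hw)⟩

/-- If `φ - ζ` divides `g ^ N` up to an error `τ ≤ 1` on `B`, then the same holds for
`g ^ (N * k)`. -/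
lemma exists_forall_norm_eval_pow_mul_sub_lt {σ : Type*} {B : Set (σ → ℂ)}
    {ψ g : MvPolynomial σ ℂ} {τ : ℝ} (hτ : τ ≤ 1) {N k : ℕ} (hk : k ≠ 0)
    (h : ∃ u, ∀ b ∈ B, ‖eval b (g ^ N - ψ * u)‖ < τ) :
    ∃ u, ∀ b ∈ B, ‖eval b (g ^ (N * k) - ψ * u)‖ < τ := by
  obtain ⟨u, hu⟩ := h
  obtain ⟨v, hv⟩ : ψ ∣ g ^ (N * k) - (g ^ N - ψ * u) ^ k := by
    rw [pow_mul]
    refine Dvd.dvd.trans ?_ (sub_dvd_pow_sub_pow _ _ k)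
    exact ⟨u, by ring⟩
  refine ⟨v, fun b hb => ?_⟩
  have : g ^ (N * k) - ψ * v = (g ^ N - ψ * u) ^ k := by rw [← hv]; ring
  rw [this, map_pow, norm_pow]
  have h0 := norm_nonneg (eval b (g ^ N - ψ * u))
  exact (pow_le_of_le_one h0 ((hu b hb).le.trans hτ) hk).trans_lt (hu b hb)

/-- Finitely many exponents can be replaced by a common one, of the form `N * m` for every `m`. -/
lemma exists_pow_forall_closedAnnulus {σ : Type*} {B : Set (σ → ℂ)} (hB : IsCompact B)
    {φ g : MvPolynomial σ ℂ} {A : Set ℂ} (hA : IsCompact A) {τ : ℝ} (hτ : 0 < τ) (hτ1 : τ ≤ 1)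
    (h : ∀ ζ ∈ A, ∀ y ∈ polyHull B, eval y φ = ζ → ‖eval y g‖ < 1) :
    ∃ N : ℕ, N ≠ 0 ∧ ∀ m : ℕ, m ≠ 0 → ∀ ζ ∈ A, ∃ u : MvPolynomial σ ℂ,
      ∀ b ∈ B, ‖eval b (g ^ (N * m) - (φ - C ζ) * u)‖ < τ := by
  have key : ∃ N : ℕ, N ≠ 0 ∧ ∀ ζ ∈ A, ∃ u : MvPolynomial σ ℂ,
      ∀ b ∈ B, ‖eval b (g ^ N - (φ - C ζ) * u)‖ < τ := by
    refine hA.induction_on (p := fun S => ∃ N : ℕ, N ≠ 0 ∧ ∀ ζ ∈ S, ∃ u : MvPolynomial σ ℂ,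
      ∀ b ∈ B, ‖eval b (g ^ N - (φ - C ζ) * u)‖ < τ) ⟨1, by simp, by simp⟩ ?_ ?_ ?_
    · rintro s t hst ⟨N, hN, h⟩
      exact ⟨N, hN, fun ζ hζ => h ζ (hst hζ)⟩
    · rintro s t ⟨N, hN, h⟩ ⟨N', hN', h'⟩
      refine ⟨N * N', mul_ne_zero hN hN', ?_⟩
      rintro ζ (hζ | hζ)
      · exact exists_forall_norm_eval_pow_mul_sub_lt hτ1 hN' (h ζ hζ)
      · rw [mul_comm]
        exact exists_forall_norm_eval_pow_mul_sub_lt hτ1 hN (h' ζ hζ)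
    · intro ζ hζ
      obtain ⟨N, hN, u, hu⟩ := exists_pow_sub_mul_lt hB (φ := φ - C ζ) (g := g)
        (fun y hy hy0 => h ζ hζ y hy (by simpa [sub_eq_zero] using hy0)) hτ
      exact ⟨_, mem_nhdsWithin_of_mem_nhds
        ((isOpen_setOf_forall_norm_eval_lt hB φ (g ^ N) u τ).mem_nhds hu), N, hN.ne',
        fun ζ' hζ' => ⟨u, hζ'⟩⟩
  obtain ⟨N, hN, h⟩ := key
  exact ⟨N, hN, fun m hm ζ hζ => exists_forall_norm_eval_pow_mul_sub_lt hτ1 hm (h ζ hζ)⟩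

/-- A form of Rossi's local maximum modulus principle. -/
theorem mem_polyHull_of_norm_eval_le {σ : Type*} [Fintype σ] {B : Set (σ → ℂ)} (hB : IsCompact B)
    (φ : MvPolynomial σ ℂ) {r : ℝ} (hr : 0 < r) {x : σ → ℂ} (hx : x ∈ polyHull B)
    (hxr : ‖eval x φ‖ ≤ r) :
    x ∈ polyHull ({b ∈ B | ‖eval b φ‖ ≤ r} ∪ {y ∈ polyHull B | ‖eval y φ‖ = r}) := by
  intro P c hc hP
  by_contra! hlt
  have hXc := isCompact_polyHull hB
  have hφc := (continuous_eval_mvPolynomial φ).norm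
  have hPx : 0 < ‖eval x P‖ := hc.trans_lt hlt
  have hPx0 : eval x P ≠ 0 := norm_pos_iff.mp hPx
  set g : MvPolynomial σ ℂ := C (eval x P)⁻¹ * P with hg
  have hgx : eval x g = 1 := by simp [hg, hPx0]
  have hglt : ∀ y, ‖eval y P‖ ≤ c → ‖eval y g‖ < 1 := fun y hy => by
    simp only [hg, map_mul, eval_C, norm_mul, norm_inv]
    rw [inv_mul_lt_one₀ hPx]
    exact hy.trans_lt hlt
  have hxr' : ‖eval x φ‖ < r := hxr.lt_of_ne fun h => hlt.not_ge (hP x (Or.inr ⟨hx, h⟩))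
  have hgc := (continuous_eval_mvPolynomial g).norm
  have hZ : IsCompact ({y ∈ polyHull B | 1 ≤ ‖eval y g‖ ∧ r ≤ ‖eval y φ‖} ∪
      {b ∈ B | 1 ≤ ‖eval b g‖}) :=
    (hXc.inter_right ((isClosed_le continuous_const hgc).inter
      (isClosed_le continuous_const hφc))).union
      (hB.inter_right (isClosed_le continuous_const hgc))
  obtain ⟨r', hrr', hr'⟩ := hZ.exists_gt_forall_lt hφc (r := r) (by
    rintro y (⟨hy, hy1, hy2⟩ | ⟨hy, hy1⟩)
    · exact hy2.lt_of_ne fun h => (hglt y (hP y (Or.inr ⟨hy, h.symm⟩))).not_ge hy1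
    · by_contra! h
      exact (hglt y (hP y (Or.inl ⟨hy, h⟩))).not_ge hy1)
  obtain ⟨M, hM0, hM⟩ := exists_setIntegral_annulusKernel_le hrr'
  set τ : ℝ := 1 / (4 * (M + 1)) with hτdef
  have hτ : 0 < τ := by positivity
  have hτ1 : τ ≤ 1 := by rw [hτdef, div_le_one (by positivity)]; linarith
  have hτM : 3 * (τ * M) < 1 := by
    rw [hτdef, one_div, inv_mul_eq_div, ← mul_div_assoc, div_lt_one (by positivity)]; linarith
  obtain ⟨N, hN, hNm⟩ := exists_pow_forall_closedAnnulus hB (φ := φ) (g := g)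
    (isCompact_closedAnnulus r r') hτ hτ1 (by
      rintro ζ hζ y hy rfl
      by_contra! h
      exact (hr' y (Or.inl ⟨hy, h, hζ.1⟩)).not_ge hζ.2)
  obtain ⟨q, hq1, hq⟩ := IsCompact.exists_gt_forall_lt
    (hB.inter_right (isClosed_le hφc continuous_const) : IsCompact (B ∩ {b | ‖eval b φ‖ ≤ r'}))
    (f := fun b => -‖eval b g‖) hgc.neg (r := -1) (by
      rintro b ⟨hb, hbr⟩
      by_contra! h
      exact (hr' b (Or.inr ⟨hb, by linarith⟩)).not_ge hbr)
  obtain ⟨m, hm0, hm⟩ : ∃ m : ℕ, m ≠ 0 ∧ (max (-q) 0) ^ m < τ := by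
    have := tendsto_pow_atTop_nhds_zero_of_lt_one (le_max_right (-q) 0)
      (max_lt (by linarith) one_pos)
    obtain ⟨m, h1, h2⟩ := ((this.eventually_lt_const hτ).and (eventually_ne_atTop 0)).exists
    exact ⟨m, h2, h1⟩
  have hsmall : ∀ b ∈ B, ‖eval b φ‖ ≤ r' → ‖eval b (g ^ (N * m))‖ ≤ τ := fun b hb hbr => by
    have h1 : ‖eval b g‖ ≤ max (-q) 0 := by
      have := hq b ⟨hb, hbr⟩
      exact le_max_of_le_left (by linarith)
    rw [map_pow, norm_pow, mul_comm, pow_mul]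
    calc (‖eval b g‖ ^ m) ^ N ≤ ((max (-q) 0) ^ m) ^ N := by gcongr
      _ ≤ (max (-q) 0) ^ m := pow_le_of_le_one (by positivity) (hm.le.trans hτ1) hN
      _ ≤ τ := hm.le
  obtain ⟨H, hH⟩ := exists_norm_eval_sub_mul_integral_le hB hr hrr' hτ hM (hNm m hm0)
  have hHB : ∀ b ∈ B, ‖eval b H‖ ≤ 2 * (τ * M) := fun b hb => by
    have h1 := hH b (subset_polyHull B hb)
    rcases le_or_gt ‖eval b φ‖ r' with hbr | hbr
    · have h2 : ‖eval b (g ^ (N * m)) * ∫ ζ in closedAnnulus r r',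
          annulusKernel r r' ζ * (ζ - eval b φ)⁻¹‖ ≤ τ * M := by
        rw [norm_mul]
        exact mul_le_mul (hsmall b hb hbr) ((norm_integral_le_integral_norm _).trans (hM _))
          (norm_nonneg _) hτ.le
      have := norm_sub_norm_le (eval b H) (eval b (g ^ (N * m)) * ∫ ζ in closedAnnulus r r',
          annulusKernel r r' ζ * (ζ - eval b φ)⁻¹)
      linarith
    · rw [setIntegral_annulusKernel_of_gt hr hrr' hbr, mul_zero, sub_zero] at h1
      have : 0 ≤ τ * M := by positivity
      linarith
  have h1 := hx H _ (by positivity) hHB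
  have h2 := hH x hx
  rw [setIntegral_annulusKernel_of_lt hr hrr' hxr', map_pow, hgx, one_pow, mul_one] at h2
  have h3 := norm_sub_norm_le (1 : ℂ) (eval x H)
  rw [norm_sub_rev, norm_one] at h3
  linarith

lemma isCompact_setOf_polydisc {σ : Type*} [Fintype σ] {B : Set (σ → ℂ)} (hB : IsCompact B)
    (p : σ → ℂ) (r : ℝ) (s : Finset σ) :
    IsCompact {b | (∀ i ∈ s, ‖b i - p i‖ ≤ r) ∧
      (b ∈ B ∨ (b ∈ polyHull B ∧ ∃ i ∈ s, ‖b i - p i‖ = r))} := by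
  have hc : ∀ i, Continuous fun b : σ → ℂ => ‖b i - p i‖ := fun i => by fun_prop
  have h1 : IsClosed {b : σ → ℂ | ∀ i ∈ s, ‖b i - p i‖ ≤ r} := by
    simp only [ofPred_forall]
    exact isClosed_biInter fun i _ => isClosed_le (hc i) continuous_const
  have h2 : IsClosed {b : σ → ℂ | ∃ i ∈ s, ‖b i - p i‖ = r} := by
    have : {b : σ → ℂ | ∃ i ∈ s, ‖b i - p i‖ = r} = ⋃ i ∈ s, {b | ‖b i - p i‖ = r} := by
      ext b; simp
    rw [this]
    exact isClosed_biUnion_finset fun i _ => isClosed_eq (hc i) continuous_const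
  exact (hB.union ((isCompact_polyHull hB).inter_right h2)).inter_left h1

lemma mem_polyHull_polydisc {σ : Type*} [Fintype σ] {B : Set (σ → ℂ)} (hB : IsCompact B)
    (p : σ → ℂ) {r : ℝ} (hr : 0 < r) {x : σ → ℂ} (hx : x ∈ polyHull B) (s : Finset σ)
    (hxs : ∀ i ∈ s, ‖x i - p i‖ ≤ r) :
    x ∈ polyHull {b | (∀ i ∈ s, ‖b i - p i‖ ≤ r) ∧
      (b ∈ B ∨ (b ∈ polyHull B ∧ ∃ i ∈ s, ‖b i - p i‖ = r))} := by
  classical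
  induction s using Finset.induction_on with
  | empty => simpa using hx
  | insert j s hj ih =>
    have hx' := ih fun i hi => hxs i (Finset.mem_insert_of_mem hi)
    refine polyHull_mono ?_ (mem_polyHull_of_norm_eval_le (isCompact_setOf_polydisc hB p r s)
      (X j - C (p j)) hr hx' (by simpa using hxs j (Finset.mem_insert_self j s)))
    rintro b (⟨⟨h1, h2⟩, h3⟩ | ⟨h1, h2⟩)
    · simp only [map_sub, eval_X, eval_C] at h3
      refine ⟨by simpa [h3] using h1, h2.imp_right ?_⟩
      rintro ⟨hb, i, hi, h⟩
      exact ⟨hb, i, Finset.mem_insert_of_mem hi, h⟩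
    · simp only [map_sub, eval_X, eval_C] at h2
      have hb : b ∈ polyHull B := by
        refine polyHull_subset_of_subset_polyHull ?_ h1
        rintro y ⟨-, hy | hy⟩
        · exact subset_polyHull B hy
        · exact hy.1
      refine ⟨?_, Or.inr ⟨hb, j, Finset.mem_insert_self j s, h2⟩⟩
      simp only [Finset.mem_insert, forall_eq_or_imp, h2, le_refl, true_and]
      intro i hi
      have := h1 (X i - C (p i)) r hr.le fun y hy => by simpa using hy.1 i hi
      simpa only [map_sub, eval_X, eval_C] using this

/-- Functions that are uniform limits of polynomials on `Q`. -/
def PolyApproxOn {σ : Type*} (Q : Set (σ → ℂ)) (g : (σ → ℂ) → ℂ) : Prop :=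
  ∀ ε > 0, ∃ P : MvPolynomial σ ℂ, ∀ x ∈ Q, ‖g x - eval x P‖ ≤ ε

namespace PolyApproxOn

variable {σ : Type*} {Q : Set (σ → ℂ)} {f g : (σ → ℂ) → ℂ}

lemma mono {Q' : Set (σ → ℂ)} (hf : PolyApproxOn Q f) (h : Q' ⊆ Q) : PolyApproxOn Q' f :=
  fun ε hε => (hf ε hε).imp fun _ hP x hx => hP x (h hx)

lemma one : PolyApproxOn Q fun _ => 1 := fun ε hε => ⟨1, fun x _ => by simpa using hε.le⟩

lemma exists_bound (hQ : IsCompact Q) (hf : PolyApproxOn Q f) :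
    ∃ c, 0 < c ∧ ∀ x ∈ Q, ‖f x‖ ≤ c := by
  obtain ⟨P, hP⟩ := hf 1 one_pos
  obtain ⟨c, hc⟩ := hQ.exists_bound_of_continuousOn (continuous_eval_mvPolynomial P).continuousOn
  refine ⟨|c| + 1, by positivity, fun x hx => ?_⟩
  have := norm_sub_norm_le (f x) (eval x P)
  linarith [hP x hx, hc x hx, le_abs_self c]

lemma mul (hQ : IsCompact Q) (hf : PolyApproxOn Q f) (hg : PolyApproxOn Q g) :
    PolyApproxOn Q fun x => f x * g x := by
  intro ε hε
  obtain ⟨c, hc0, hc⟩ := hf.exists_bound hQ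
  obtain ⟨P, hP⟩ := hg (ε / (2 * c)) (by positivity)
  obtain ⟨d, hd⟩ := hQ.exists_bound_of_continuousOn (continuous_eval_mvPolynomial P).continuousOn
  obtain ⟨R, hR⟩ := hf (ε / (2 * (|d| + 1))) (by positivity)
  refine ⟨R * P, fun x hx => ?_⟩
  have : f x * g x - eval x (R * P) =
      f x * (g x - eval x P) + (f x - eval x R) * eval x P := by rw [map_mul]; ring
  rw [this]
  refine (norm_add_le _ _).trans ?_
  rw [norm_mul, norm_mul]
  calc _ ≤ c * (ε / (2 * c)) + ε / (2 * (|d| + 1)) * (|d| + 1) := by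
        gcongr
        · exact hc x hx
        · exact hP x hx
        · exact hR x hx
        · linarith [hd x hx, le_abs_self d]
    _ = ε := by field_simp; ring

lemma pow (hQ : IsCompact Q) (hf : PolyApproxOn Q f) (N : ℕ) :
    PolyApproxOn Q fun x => f x ^ N := by
  induction N with
  | zero => simpa using one
  | succ N ih => simpa only [pow_succ] using ih.mul hQ hf

lemma norm_le_of_mem_polyHull {B : Set (σ → ℂ)} (hg : PolyApproxOn Q g) (hBQ : B ⊆ Q)
    {c : ℝ} (hc : 0 ≤ c) (hB : ∀ b ∈ B, ‖g b‖ ≤ c) {y : σ → ℂ} (hy : y ∈ polyHull B)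
    (hyQ : y ∈ Q) : ‖g y‖ ≤ c := by
  refine le_of_forall_pos_le_add fun ε hε => ?_
  obtain ⟨P, hP⟩ := hg (ε / 2) (by positivity)
  have h1 := hy P (c + ε / 2) (by positivity) fun b hb => by
    have := norm_sub_norm_le (eval b P) (g b)
    rw [norm_sub_rev] at this
    linarith [hP b (hBQ hb), hB b hb]
  have := norm_sub_norm_le (g y) (eval y P)
  linarith [hP y hyQ]

end PolyApproxOn

lemma exists_eval_eq_continuousMultilinearMap {σ : Type*} [Fintype σ] {k : ℕ}
    (q : (σ → ℂ) [×k]→L[ℂ] ℂ) (p : σ → ℂ) :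
    ∃ P : MvPolynomial σ ℂ, ∀ x, eval x P = q fun _ => x - p := by
  classical
  refine ⟨∑ j : Fin k → σ, (∏ i, (X (j i) - C (p (j i)))) *
    C (q fun i => Pi.single (j i) (1 : ℂ)), fun x => ?_⟩
  have h : x - p = ∑ i, (x i - p i) • (Pi.single i 1 : σ → ℂ) := by
    ext i
    simp [Finset.sum_apply, Pi.single_apply]
  conv_rhs => rw [h]
  rw [q.map_sum]
  simp [ContinuousMultilinearMap.map_smul_univ]

lemma exists_polyApproxOn_closedBall {σ : Type*} [Fintype σ] {g : (σ → ℂ) → ℂ} {p : σ → ℂ}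
    (hg : AnalyticAt ℂ g p) :
    ∃ r₀ > 0, ∀ r ≤ r₀, PolyApproxOn (closedBall p r) g := by
  obtain ⟨q, R, hq⟩ := hg
  obtain ⟨r', hr'0, hr'⟩ := ENNReal.lt_iff_exists_nnreal_btwn.mp hq.r_pos
  have hr'0 : 0 < r' := by exact_mod_cast hr'0
  refine ⟨r' / 2, by positivity, fun r hr ε hε => ?_⟩
  have h := (Metric.tendstoUniformlyOn_iff.mp (hq.tendstoUniformlyOn' hr') ε hε).exists
  obtain ⟨N, hN⟩ := h
  choose P hP using fun k => exists_eval_eq_continuousMultilinearMap (q k) p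
  refine ⟨∑ k ∈ Finset.range N, P k, fun x hx => ?_⟩
  have := hN x ((closedBall_subset_ball (hr.trans_lt (half_lt_self hr'0))) hx)
  rw [dist_eq_norm] at this
  simpa [FormalMultilinearSeries.partialSum, hP] using this.le

lemma le_of_forall_pow_le_mul_pow {u v D : ℝ} (hv : 0 < v) (h : ∀ N : ℕ, u ^ N ≤ D * v ^ N) :
    u ≤ v := by
  by_contra! huv
  obtain ⟨N, hN⟩ := pow_unbounded_of_one_lt D ((one_lt_div hv).mpr huv)
  rw [div_pow, lt_div_iff₀ (by positivity)] at hN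
  exact (h N).not_gt hN

lemma Polynomial.norm_coeff_le_of_forall_norm_eval_le (p : Polynomial ℂ) {c : ℝ} (hc : 0 ≤ c)
    (h : ∀ t : ℂ, ‖t‖ = 1 → ‖p.eval t‖ ≤ c) (d : ℕ) : ‖p.coeff d‖ ≤ c := by
  by_cases hd : d ∈ p.support
  · have h1 : ‖p.coeff d‖ ^ 2 ≤ c ^ 2 := by
      calc ‖p.coeff d‖ ^ 2 ≤ ∑ i ∈ p.support, ‖p.coeff i‖ ^ 2 :=
            Finset.single_le_sum (f := fun i => ‖p.coeff i‖ ^ 2) (fun _ _ => by positivity) hd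
        _ = Real.circleAverage (fun θ ↦ ‖p.eval θ‖ ^ 2) 0 1 :=
            p.sum_sq_norm_coeff_eq_circleAverage
        _ ≤ c ^ 2 := by
          refine Real.circleAverage_mono_on_of_le_circle ?_ fun t ht => ?_
          · exact ContinuousOn.circleIntegrable' (by fun_prop)
          · have := h t (by simpa using ht)
            gcongr
    exact (sq_le_sq₀ (norm_nonneg _) hc).mp h1
  · simpa [Polynomial.notMem_support_iff.mp hd] using hc

namespace MvPolynomial

lemma IsHomogeneous.eval_smul_eq {σ : Type*} {P : MvPolynomial σ ℂ} {d : ℕ}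
    (hP : P.IsHomogeneous d) (t : ℂ) (x : σ → ℂ) : eval (t • x) P = t ^ d * eval x P := by
  rw [eval_eq, eval_eq, Finset.mul_sum]
  refine Finset.sum_congr rfl fun s hs => ?_
  rw [hP.degree_eq_sum_deg_support hs]
  simp only [Pi.smul_apply, smul_eq_mul, mul_pow, Finset.prod_mul_distrib]
  rw [Finset.prod_pow_eq_pow_sum]
  ring

lemma totalDegree_aeval_le {σ τ : Type*} {f : σ → MvPolynomial τ ℂ}
    (hf : ∀ i, (f i).totalDegree ≤ 1) (P : MvPolynomial σ ℂ) :
    (aeval f P).totalDegree ≤ P.totalDegree := by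
  rw [aeval_def, eval₂_eq]
  refine totalDegree_finsetSum_le fun s hs => ?_
  refine (totalDegree_mul _ _).trans ?_
  rw [algebraMap_eq, totalDegree_C, zero_add]
  refine (totalDegree_finsetProd _ _).trans (le_trans ?_ (le_totalDegree hs))
  refine Finset.sum_le_sum fun i _ => (totalDegree_pow _ _).trans ?_
  simpa using Nat.mul_le_mul_left (s i) (hf i)

lemma norm_eval_homogeneousComponent_le {σ : Type*} (P : MvPolynomial σ ℂ) (x : σ → ℂ) {c : ℝ}
    (hc : 0 ≤ c) (h : ∀ t : ℂ, ‖t‖ = 1 → ‖eval (t • x) P‖ ≤ c) (d : ℕ) :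
    ‖eval x (homogeneousComponent d P)‖ ≤ c := by
  by_cases hd : d < P.totalDegree + 1
  · set q : Polynomial ℂ := ∑ i ∈ Finset.range (P.totalDegree + 1),
      Polynomial.monomial i (eval x (homogeneousComponent i P)) with hq
    have hqd : q.coeff d = eval x (homogeneousComponent d P) := by
      simp only [hq, Polynomial.finsetSum_coeff, Polynomial.coeff_monomial]
      simp [hd]
    rw [← hqd]
    refine q.norm_coeff_le_of_forall_norm_eval_le hc (fun t ht => ?_) d
    convert h t ht using 2
    conv_rhs => rw [← sum_homogeneousComponent P]
    rw [hq, Polynomial.eval_finsetSum, map_sum]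
    refine Finset.sum_congr rfl fun i _ => ?_
    rw [(homogeneousComponent_isHomogeneous i P).eval_smul_eq, Polynomial.eval_monomial, mul_comm]
  · rw [homogeneousComponent_eq_zero _ _ (by omega)]
    simpa using hc

end MvPolynomial

/-- The circled set over `K` in the tautological line bundle, in homogeneous coordinates. -/
def circledLift {n : ℕ} (K : Set (Fin n → ℂ)) : Set (Fin (n + 1) → ℂ) :=
  image2 (fun (t : ℂ) (z : Fin n → ℂ) => t • (Fin.cons 1 z : Fin (n + 1) → ℂ)) (sphere 0 1) K

lemma isCompact_circledLift {n : ℕ} {K : Set (Fin n → ℂ)} (hK : IsCompact K) :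
    IsCompact (circledLift K) := by
  rw [circledLift, ← image_prod]
  refine ((isCompact_sphere (0 : ℂ) 1).prod hK).image (continuous_pi fun i => ?_)
  refine Fin.cases ?_ (fun j => ?_) i
  · simp only [Pi.smul_apply, Fin.cons_zero]
    fun_prop
  · simp only [Pi.smul_apply, Fin.cons_succ]
    fun_prop

lemma exists_mem_polyHull_circledLift {n : ℕ} {K : Set (Fin n → ℂ)} {a : Fin n → ℂ}
    (ha : a ∈ projHull n K) :
    ∃ ρ : ℝ, 0 < ρ ∧ (ρ : ℂ) • (Fin.cons 1 a : Fin (n + 1) → ℂ) ∈ polyHull (circledLift K) := by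
  obtain ⟨D, hD, hDK⟩ := ha
  refine ⟨1 / (2 * D), by positivity, ?_⟩
  set ρ : ℝ := 1 / (2 * D) with hρ
  set x : Fin (n + 1) → ℂ := (ρ : ℂ) • (Fin.cons 1 a : Fin (n + 1) → ℂ) with hx
  have key : ∀ (P : MvPolynomial (Fin (n + 1)) ℂ) (c : ℝ), 0 < c →
      (∀ b ∈ circledLift K, ‖eval b P‖ ≤ c) → ‖eval x P‖ ≤ 2 * D * c := by
    intro P c hc hP
    have hd : ∀ d, ‖eval x (homogeneousComponent d P)‖ ≤ D * c * (1 / 2) ^ d := by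
      intro d
      set Pd := homogeneousComponent d P with hPd
      have hPh : Pd.IsHomogeneous d := homogeneousComponent_isHomogeneous d P
      set p : MvPolynomial (Fin n) ℂ :=
        aeval (Fin.cons 1 X : Fin (n + 1) → MvPolynomial (Fin n) ℂ) Pd with hp
      have hpe : ∀ z, eval z p = eval (Fin.cons 1 z : Fin (n + 1) → ℂ) Pd := by
        intro z
        have : eval z p = aeval z p := by rw [aeval_eq_eval]
        rw [this, hp, ← AlgHom.comp_apply, comp_aeval, aeval_eq_eval]
        congr 2
        ext i
        refine Fin.cases ?_ (fun j => ?_) i <;> simp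
      have hpd : (C (c : ℂ)⁻¹ * p).totalDegree ≤ d + 1 := by
        refine (totalDegree_mul _ _).trans ?_
        rw [totalDegree_C, zero_add]
        refine (totalDegree_aeval_le (fun i => ?_) _).trans (hPh.totalDegree_le.trans d.le_succ)
        refine Fin.cases ?_ (fun j => ?_) i <;> simp
      have hpa := hDK (d + 1) (by omega) _ hpd fun w hw => by
        rw [map_mul, eval_C, norm_mul, norm_inv, Complex.norm_real, Real.norm_of_nonneg hc.le,
          inv_mul_le_one₀ hc, hpe]
        exact norm_eval_homogeneousComponent_le P _ hc.le
          (fun t ht => hP _ ⟨t, by simpa using ht, w, hw, rfl⟩) d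
      rw [map_mul, eval_C, norm_mul, norm_inv, Complex.norm_real, Real.norm_of_nonneg hc.le,
          inv_mul_le_iff₀ hc, hpe] at hpa
      rw [hx, hPh.eval_smul_eq, norm_mul, norm_pow, Complex.norm_real, Real.norm_of_nonneg
        (by positivity)]
      calc _ ≤ ρ ^ d * (c * D ^ (d + 1)) := by gcongr
        _ = D * c * (ρ * D) ^ d := by ring
        _ = _ := by congr 2; rw [hρ]; field_simp
    calc ‖eval x P‖ = ‖∑ d ∈ Finset.range (P.totalDegree + 1),
          eval x (homogeneousComponent d P)‖ := by rw [← map_sum, sum_homogeneousComponent]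
      _ ≤ ∑ d ∈ Finset.range (P.totalDegree + 1), D * c * (1 / 2) ^ d :=
          norm_sum_le_of_le _ fun d _ => hd d
      _ ≤ D * c * 2 := by
          rw [← Finset.mul_sum]
          gcongr
          exact sum_geometric_two_le _
      _ = _ := by ring
  intro P c hc hP
  refine le_of_forall_gt_imp_ge_of_dense fun c' hc' => ?_
  have hc'0 : 0 < c' := hc.trans_lt hc'
  refine le_of_forall_pow_le_mul_pow (D := 2 * D) hc'0 fun N => ?_
  have := key (P ^ N) (c' ^ N) (by positivity) fun b hb => by
    rw [map_pow, norm_pow]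
    have := (hP b hb).trans hc'.le
    gcongr
  rwa [map_pow, norm_pow] at this

lemma norm_le_of_mem_polyHull_of_local {σ : Type*} [Fintype σ] {B : Set (σ → ℂ)}
    (hB : IsCompact B) {p : σ → ℂ} {r : ℝ} (hr : 0 < r) {g G : (σ → ℂ) → ℂ}
    (hg : PolyApproxOn (closedBall p r) g) (hG : PolyApproxOn (closedBall p r) G)
    {y : σ → ℂ} (hy : y ∈ polyHull B) (hyp : y ∈ closedBall p r) (hGy : G y ≠ 0)
    {v : ℝ} (hv : 0 < v) (h1 : ∀ b ∈ B, b ∈ closedBall p r → G b = 0)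
    (h2 : ∀ b ∈ polyHull B, b ∈ closedBall p r → (∃ i, ‖b i - p i‖ = r) → G b = 0 ∨ ‖g b‖ ≤ v) :
    ‖g y‖ ≤ v := by
  have hQ : IsCompact (closedBall p r) := isCompact_closedBall p r
  have hball : ∀ b : σ → ℂ, (∀ i ∈ Finset.univ, ‖b i - p i‖ ≤ r) ↔ b ∈ closedBall p r := fun b => by
    rw [mem_closedBall, dist_eq_norm, pi_norm_le_iff_of_nonneg hr.le]
    simp
  obtain ⟨c, hc0, hc⟩ := hG.exists_bound hQ
  have hGy0 : 0 < ‖G y‖ := norm_pos_iff.mpr hGy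
  have hloc := mem_polyHull_polydisc hB p hr hy Finset.univ ((hball y).mpr hyp)
  refine le_of_forall_pow_le_mul_pow (D := c / ‖G y‖) hv fun N => ?_
  have := ((hg.pow hQ N).mul hQ hG).norm_le_of_mem_polyHull (c := v ^ N * c)
    (fun b hb => (hball b).mp hb.1) (by positivity) (by
      rintro b ⟨hb, hb'⟩
      rw [hball] at hb
      have : G b = 0 ∨ ‖g b‖ ≤ v := by
        rcases hb' with hb' | ⟨hb', i, -, hi⟩
        · exact Or.inl (h1 b hb' hb)
        · exact h2 b hb' hb ⟨i, hi⟩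
      rcases this with h | h
      · simp only [h, mul_zero, norm_zero]
        positivity
      · rw [norm_mul, norm_pow]
        gcongr
        exact hc b hb) hloc hyp
  rw [norm_mul, norm_pow] at this
  rw [div_mul_eq_mul_div, le_div_iff₀ hGy0]
  linarith

lemma analyticAt_apply {σ : Type*} [Fintype σ] (i : σ) (p : σ → ℂ) :
    AnalyticAt ℂ (fun x : σ → ℂ => x i) p :=
  (ContinuousLinearMap.proj (R := ℂ) (φ := fun _ : σ => ℂ) i).analyticAt p

/-- The affine coordinates of a point given by homogeneous coordinates. -/
noncomputable def affineChart {n : ℕ} (x : Fin (n + 1) → ℂ) : Fin n → ℂ := fun i => x i.succ / x 0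

lemma affineChart_smul_cons {n : ℕ} {t : ℂ} (ht : t ≠ 0) (z : Fin n → ℂ) :
    affineChart (t • (Fin.cons 1 z : Fin (n + 1) → ℂ)) = z := by
  ext i
  simp [affineChart, ht]

lemma analyticAt_affineChart {n : ℕ} {p : Fin (n + 1) → ℂ} (hp : p 0 ≠ 0) :
    AnalyticAt ℂ (affineChart (n := n)) p :=
  AnalyticAt.pi fun i => (analyticAt_apply i.succ p).fun_div (analyticAt_apply 0 p) hp

/-- The peaking function at `p` of the weight `‖x 0‖ * exp (δ * ∑ i, ‖x i‖ ^ 2)`. -/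
noncomputable def peakFun {n : ℕ} (δ : ℝ) (p x : Fin (n + 1) → ℂ) : ℂ :=
  x 0 * Complex.exp (δ * ∑ i, (2 * x i * (starRingEnd ℂ) (p i) - (‖p i‖ : ℂ) ^ 2))

lemma analyticAt_peakFun {n : ℕ} (δ : ℝ) (p q : Fin (n + 1) → ℂ) :
    AnalyticAt ℂ (peakFun δ p) q := by
  refine (analyticAt_apply 0 q).mul (AnalyticAt.cexp (analyticAt_const.mul ?_))
  exact Finset.analyticAt_fun_sum _ fun i _ =>
    ((analyticAt_const.mul (analyticAt_apply i q)).mul analyticAt_const).sub analyticAt_const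

lemma norm_peakFun {n : ℕ} (δ : ℝ) (p x : Fin (n + 1) → ℂ) :
    ‖peakFun δ p x‖ =
      ‖x 0‖ * Real.exp (δ * ∑ i, ‖x i‖ ^ 2) * Real.exp (-(δ * ∑ i, ‖x i - p i‖ ^ 2)) := by
  rw [peakFun, norm_mul, Complex.norm_exp, mul_assoc, ← Real.exp_add, Complex.re_ofReal_mul,
    Complex.re_sum, ← sub_eq_add_neg, ← mul_sub, ← Finset.sum_sub_distrib]
  congr 4
  ext i
  have h : ((‖p i‖ : ℂ) ^ 2).re = ‖p i‖ ^ 2 := by rw [← Complex.ofReal_pow, Complex.ofReal_re]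
  rw [Complex.sub_re, h]
  simp only [← Complex.normSq_eq_norm_sq, Complex.normSq_apply, Complex.sub_re, Complex.sub_im,
    Complex.mul_re, Complex.mul_im, Complex.conj_re, Complex.conj_im, Complex.re_ofNat,
    Complex.im_ofNat]
  ring

/-- The projective hull of a compact subset of an analytic variety lies in this variety. -/
theorem projHull_subset_of_subset_variety {n : ℕ} {Sig : Set (Fin n → ℂ)}
    (hvar : ∀ z : Fin n → ℂ, ∃ U ∈ 𝓝 z, ∃ (m : ℕ) (f : Fin m → (Fin n → ℂ) → ℂ),
        (∀ i, AnalyticAt ℂ (f i) z) ∧ ∀ w ∈ U, w ∈ Sig ↔ ∀ i, f i w = 0)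
    {K : Set (Fin n → ℂ)} (hK : IsCompact K) (hKS : K ⊆ Sig) : projHull n K ⊆ Sig := by
  intro a ha
  by_contra haS
  obtain ⟨ρ, hρ, hx₀⟩ := exists_mem_polyHull_circledLift ha
  set x₀ : Fin (n + 1) → ℂ := (ρ : ℂ) • (Fin.cons 1 a : Fin (n + 1) → ℂ) with hx₀def
  have hB := isCompact_circledLift hK
  have hX := isCompact_polyHull hB
  set Y := polyHull (circledLift K)
  obtain ⟨R, hR⟩ := hX.exists_bound_of_continuousOn
    (f := fun x : Fin (n + 1) → ℂ => ∑ i, ‖x i‖ ^ 2) (by fun_prop)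
  have hR0 : 0 ≤ R := (norm_nonneg _).trans (hR _ hx₀)
  have hlog : 0 < Real.log 2 := Real.log_pos one_lt_two
  set δ : ℝ := Real.log 2 / (R + 1) with hδdef
  have hδ : 0 < δ := by positivity
  set F : (Fin (n + 1) → ℂ) → ℝ := fun x => ‖x 0‖ * Real.exp (δ * ∑ i, ‖x i‖ ^ 2) with hF
  have hFc : Continuous F := by fun_prop
  have hF2 : ∀ x ∈ Y, F x ≤ ‖x 0‖ * 2 := fun x hx => by
    refine mul_le_mul_of_nonneg_left ?_ (norm_nonneg _)
    rw [← Real.le_log_iff_exp_le two_pos, hδdef, div_mul_eq_mul_div, div_le_iff₀ (by positivity)]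
    gcongr
    linarith [le_abs_self (∑ i, ‖x i‖ ^ 2), hR x hx, Real.norm_eq_abs (∑ i, ‖x i‖ ^ 2)]
  set S : Set (Fin (n + 1) → ℂ) := {x ∈ Y | ρ / 4 ≤ ‖x 0‖ ∧ affineChart x ∉ Sig} with hS
  have hρ0 : (ρ : ℂ) ≠ 0 := by exact_mod_cast hρ.ne'
  have hx00 : ‖x₀ 0‖ = ρ := by simp [hx₀def, abs_of_pos hρ]
  have hx₀S : x₀ ∈ S := by
    refine ⟨hx₀, by rw [hx00]; linarith, ?_⟩
    rw [hx₀def, affineChart_smul_cons hρ0]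
    exact haS
  have hSY : closure S ⊆ Y := closure_minimal (fun x hx => hx.1) (isClosed_polyHull _)
  obtain ⟨p, hpS, hpmax⟩ := (hX.of_isClosed_subset isClosed_closure hSY).exists_isMaxOn
    ⟨x₀, subset_closure hx₀S⟩ hFc.continuousOn
  have hFS : ∀ x ∈ S, F x ≤ F p := fun x hx => hpmax (subset_closure hx)
  have hFp : ρ ≤ F p := by
    refine le_trans ?_ (hFS x₀ hx₀S)
    simp only [hF, hx00]
    exact le_mul_of_one_le_right hρ.le (Real.one_le_exp (by positivity))
  have hp0 : ρ / 4 < ‖p 0‖ := by linarith [hF2 p (hSY hpS)]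
  have hp00 : p 0 ≠ 0 := norm_pos_iff.mp (by linarith)
  obtain ⟨U, hU, m, f, hf, hUf⟩ := hvar (affineChart p)
  have hchart := analyticAt_affineChart hp00
  have hW : {x | affineChart x ∈ U ∧ ρ / 4 < ‖x 0‖} ∈ 𝓝 p :=
    inter_mem (hchart.continuousAt hU)
      ((by fun_prop : Continuous fun x : Fin (n + 1) → ℂ => ‖x 0‖).continuousAt.eventually_const_lt
        hp0)
  obtain ⟨r₁, hr₁, hr₁W⟩ := nhds_basis_closedBall.mem_iff.mp hW
  obtain ⟨r₂, hr₂, hr₂g⟩ := exists_polyApproxOn_closedBall (analyticAt_peakFun δ p p)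
  choose r₃ hr₃ hr₃G using fun i => exists_polyApproxOn_closedBall ((hf i).comp hchart)
  obtain ⟨r, hr1, hr2, hr3, hr⟩ : ∃ r, r ≤ r₁ ∧ r ≤ r₂ ∧ (∀ i, r ≤ r₃ i) ∧ 0 < r := by
    have h : ∀ ε > 0, ∀ᶠ r in 𝓝[>] (0 : ℝ), r ≤ ε := fun ε hε =>
      eventually_nhdsWithin_of_eventually_nhds (eventually_le_nhds hε)
    exact ((h r₁ hr₁).and ((h r₂ hr₂).and ((eventually_all.mpr fun i => h _ (hr₃ i)).and
      self_mem_nhdsWithin))).exists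
  have hQW : ∀ x ∈ closedBall p r, affineChart x ∈ U ∧ ρ / 4 < ‖x 0‖ := fun x hx =>
    hr₁W (closedBall_subset_closedBall hr1 hx)
  have hFp0 : 0 < F p := hρ.trans_le hFp
  set v := F p * Real.exp (-(δ * r ^ 2)) with hv
  have hlocal : ∀ y ∈ S, y ∈ closedBall p r → ‖peakFun δ p y‖ ≤ v := by
    intro y hyS hyr
    have : ∃ i, f i (affineChart y) ≠ 0 := by
      by_contra! h
      exact hyS.2.2 ((hUf _ (hQW y hyr).1).mpr h)
    obtain ⟨i, hi⟩ := this
    refine norm_le_of_mem_polyHull_of_local hB hr (hr₂g r hr2) (hr₃G i r (hr3 i)) hyS.1 hyr hi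
      (by positivity) ?_ ?_
    · rintro _ ⟨t, ht, z, hz, rfl⟩ hb
      have ht0 : t ≠ 0 := norm_pos_iff.mp (by rw [mem_sphere_zero_iff_norm.mp ht]; exact one_pos)
      have := (hUf _ (hQW _ hb).1).mp (by rw [affineChart_smul_cons ht0]; exact hKS hz) i
      exact this
    · rintro b hbY hb ⟨j, hj⟩
      by_cases hbS : affineChart b ∈ Sig
      · exact Or.inl ((hUf _ (hQW _ hb).1).mp hbS i)
      · right
        have hle := hFS b ⟨hbY, (hQW b hb).2.le, hbS⟩
        rw [norm_peakFun, hv]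
        have hj2 : r ^ 2 ≤ ∑ i, ‖b i - p i‖ ^ 2 := by
          rw [← hj]
          exact Finset.single_le_sum (f := fun i => ‖b i - p i‖ ^ 2) (fun _ _ => by positivity)
            (Finset.mem_univ j)
        gcongr
  have hpv : ‖peakFun δ p p‖ = F p := by simp [norm_peakFun, hF]
  have hvp : v < ‖peakFun δ p p‖ := by
    rw [hpv, hv]
    refine mul_lt_of_lt_one_right hFp0 (Real.exp_lt_one_iff.mpr ?_)
    have : 0 < δ * r ^ 2 := by positivity
    linarith
  have hev : ∀ᶠ y in 𝓝 p, v < ‖peakFun δ p y‖ ∧ y ∈ closedBall p r :=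
    ((analyticAt_peakFun δ p p).continuousAt.norm.eventually_const_lt hvp).and
      (closedBall_mem_nhds p hr)
  obtain ⟨y, hyS, hy1, hy2⟩ := ((mem_closure_iff_frequently.mp hpS).and_eventually hev).exists
  exact (hlocal y hyS hy2).not_gt hy1

lemma exists_norm_eval_le_of_totalDegree_le {n : ℕ} {K : Set (Fin n → ℂ)} (hK : IsCompact K)
    (hna : ∀ P : MvPolynomial (Fin n) ℂ, (∀ z ∈ K, eval z P = 0) → P = 0) (a : Fin n → ℂ) (d : ℕ) :
    ∃ D : ℝ, ∀ P : MvPolynomial (Fin n) ℂ, P.totalDegree ≤ d → (∀ w ∈ K, ‖eval w P‖ ≤ 1) →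
      ‖eval a P‖ ≤ D := by
  have : CompactSpace K := isCompact_iff_compactSpace.mp hK
  let L : restrictTotalDegree (Fin n) ℂ d →ₗ[ℂ] C(K, ℂ) :=
    (polyRestrict K).toLinearMap ∘ₗ (restrictTotalDegree (Fin n) ℂ d).subtype
  have hL : Function.Injective L := by
    rw [← LinearMap.ker_eq_bot, LinearMap.ker_eq_bot']
    intro P hP
    refine Subtype.ext (hna _ fun z hz => ?_)
    have := DFunLike.congr_fun hP ⟨z, hz⟩
    simpa [L, polyRestrict_apply] using this
  let e := LinearEquiv.ofInjective L hL
  have : FiniteDimensional ℂ (LinearMap.range L) := inferInstance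
  let ℓ : LinearMap.range L →L[ℂ] ℂ := LinearMap.toContinuousLinearMap
    ((aeval a : MvPolynomial (Fin n) ℂ →ₐ[ℂ] ℂ).toLinearMap ∘ₗ
      (restrictTotalDegree (Fin n) ℂ d).subtype ∘ₗ e.symm.toLinearMap)
  refine ⟨‖ℓ‖, fun P hP hPK => ?_⟩
  let Q : restrictTotalDegree (Fin n) ℂ d := ⟨P, (mem_restrictTotalDegree _ _ _).mpr hP⟩
  have h1 : ℓ (e Q) = eval a P := by simp [ℓ, Q, aeval_eq_eval]
  have h2 : ‖e Q‖ ≤ 1 := by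
    have : ‖L Q‖ ≤ 1 := (ContinuousMap.norm_le _ zero_le_one).mpr fun b => by
      simpa [L, Q, polyRestrict_apply] using hPK b.1 b.2
    exact this
  rw [← h1]
  exact (ℓ.le_opNorm _).trans (mul_le_of_le_one_right (norm_nonneg _) h2)

lemma exists_forall_pow_lt_norm_eval_of_notMem_projHull {n : ℕ} {K : Set (Fin n → ℂ)}
    {a : Fin n → ℂ} (ha : a ∉ projHull n K) {M : ℝ} (hM : 1 ≤ M) :
    ∃ d₀ : ℕ, ∀ d ≥ d₀, ∃ P : MvPolynomial (Fin n) ℂ,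
      P.totalDegree ≤ d ∧ (∀ w ∈ K, ‖eval w P‖ ≤ 1) ∧ M ^ d < ‖eval a P‖ := by
  simp only [projHull, mem_ofPred_eq, not_exists, not_and, not_forall, not_le] at ha
  obtain ⟨e, he, P, hPe, hPK, hP⟩ := ha (M ^ 2) (one_le_pow₀ hM)
  refine ⟨e, fun d hd => ⟨P ^ (d / e), ?_, fun w hw => ?_, ?_⟩⟩
  · calc (P ^ (d / e)).totalDegree ≤ d / e * P.totalDegree := totalDegree_pow _ _
      _ ≤ d / e * e := Nat.mul_le_mul_left _ hPe
      _ ≤ d := Nat.div_mul_le_self d e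
  · rw [map_pow, norm_pow]
    exact pow_le_one₀ (norm_nonneg _) (hPK w hw)
  · have hk : 1 ≤ d / e := (Nat.one_le_div_iff he).mpr hd
    rw [map_pow, norm_pow]
    calc M ^ d ≤ M ^ (2 * e * (d / e)) := by
          refine pow_le_pow_right₀ hM ?_
          have h1 := Nat.div_add_mod d e
          have h2 := Nat.mod_lt d he
          nlinarith
      _ = ((M ^ 2) ^ e) ^ (d / e) := by rw [← pow_mul, ← pow_mul, mul_assoc]
      _ < ‖eval a P‖ ^ (d / e) := by
          refine pow_lt_pow_left₀ hP (by positivity) (by omega)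

end

/-- If K is a compact non-algebraic subset of a closed analytic subvariety
Σ ⊆ ℂⁿ, then for every a ∉ Σ and every M ≥ 1 one has
λ_d(a) = sup{|P(a)| : deg P ≤ d, ‖P‖_K ≤ 1} > M^d for all large d;
consequently the projective hull of K is contained in Σ. -/
theorem stmt_9 (n : ℕ) (Sig : Set (Fin n → ℂ)) (hclosed : IsClosed Sig)
    (hvar : ∀ z : Fin n → ℂ, ∃ U ∈ nhds z, IsOpen U ∧
      ∃ (m : ℕ) (f : Fin m → (Fin n → ℂ) → ℂ),
        (∀ i, AnalyticOnNhd ℂ (f i) U) ∧ Sig ∩ U = {w ∈ U | ∀ i, f i w = 0})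
    (K : Set (Fin n → ℂ)) (hK : IsCompact K) (hKS : K ⊆ Sig)
    (hna : ∀ P : MvPolynomial (Fin n) ℂ, (∀ z ∈ K, eval z P = 0) → P = 0) :
    (∀ a : Fin n → ℂ, a ∉ Sig → ∀ M : ℝ, 1 ≤ M → ∃ d₀ : ℕ, ∀ d ≥ d₀,
      M ^ d < sSup {r : ℝ | ∃ P : MvPolynomial (Fin n) ℂ,
        P.totalDegree ≤ d ∧ (∀ w ∈ K, ‖eval w P‖ ≤ 1) ∧ r = ‖eval a P‖}) ∧
    projHull n K ⊆ Sig := by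
  have hsub : projHull n K ⊆ Sig := by
    refine projHull_subset_of_subset_variety (fun z => ?_) hK hKS
    obtain ⟨U, hU, -, m, f, hf, hS⟩ := hvar z
    refine ⟨U, hU, m, f, fun i => hf i z (mem_of_mem_nhds hU), fun w hw => ?_⟩
    have := Set.ext_iff.mp hS w
    simpa [hw] using this
  refine ⟨fun a ha M hM => ?_, hsub⟩
  obtain ⟨d₀, h⟩ := exists_forall_pow_lt_norm_eval_of_notMem_projHull (fun h => ha (hsub h)) hM
  refine ⟨d₀, fun d hd => ?_⟩
  obtain ⟨P, hPd, hPK, hP⟩ := h d hd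
  obtain ⟨D, hD⟩ := exists_norm_eval_le_of_totalDegree_le hK hna a d
  refine hP.trans_le (le_csSup ⟨D, ?_⟩ ⟨P, hPd, hPK, rfl⟩)
  rintro _ ⟨Q, hQd, hQK, rfl⟩
  exact hD Q hQd hQK
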